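/- For every v ∈ ℝ^n, every x ∈ 𝕋^n and every ε > 0 there exists an integer N ≥ 1 such that f_v^N(B(x,ε)) = 𝕋^n, where B(x,ε) is the open ball of radius ε around x and f_v^N denotes the N-th iterate of f_v. -/

import Mathlib

open MeasureTheory Set Filter Topology

noncomputable section

/-- The `n`-torus `𝕋ⁿ = ℝⁿ/ℤⁿ`. -/
abbrev Torus (n : ℕ) : Type := Fin n → AddCircle (1 : ℝ)

/-- The canonical projection `ℝⁿ → 𝕋ⁿ`. -/
def tproj (n : ℕ) (x : Fin n → ℝ) : Torus n := fun i => (x i : AddCircle (1 : ℝ))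

/-- The set of points of `ℝⁿ` where the inverse of the derivative of the lift `F`
has (operator) norm one. Its projection to the torus is the set `K`. -/
def KsetF (n : ℕ) (F : (Fin n → ℝ) → Fin n → ℝ) : Set (Fin n → ℝ) :=
  {x | ‖Ring.inverse (fderiv ℝ F x)‖ = 1}

/-- The hypotheses on `f : 𝕋ⁿ → 𝕋ⁿ`: `f` is a `C^{1+α}` local diffeomorphism with
lift `F`, with `‖Df(x)⁻¹‖ ≤ 1` everywhere, and `K = {‖Df(x)⁻¹‖ = 1}` finite. -/
structure TorusHyp (n : ℕ) (α : ℝ) (f : Torus n → Torus n)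
    (F : (Fin n → ℝ) → Fin n → ℝ) : Prop where
  hn : 1 ≤ n
  hα0 : 0 < α
  hα1 : α ≤ 1
  hlift : ∀ x, f (tproj n x) = tproj n (F x)
  hdiff : Differentiable ℝ F
  hHolder : ∃ C : ℝ, ∀ x y, ‖fderiv ℝ F x - fderiv ℝ F y‖ ≤ C * ‖x - y‖ ^ α
  hunit : ∀ x, IsUnit (fderiv ℝ F x)
  hinvnorm : ∀ x, ‖Ring.inverse (fderiv ℝ F x)‖ ≤ 1
  hKfin : (tproj n '' KsetF n F).Finite

/-- The basin of an invariant measure. -/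
def basin {n : ℕ} (f : Torus n → Torus n) (μ : Measure (Torus n)) : Set (Torus n) :=
  {x | ∀ φ : C(Torus n, ℝ),
    Tendsto (fun N : ℕ => (N : ℝ)⁻¹ * ∑ j ∈ Finset.range N, φ (f^[j] x)) atTop
      (𝓝 (∫ y, φ y ∂μ))}

/-- The (closed) support of a measure on a topological space. -/
def mSupport {Y : Type*} [TopologicalSpace Y] [MeasurableSpace Y] (θ : Measure Y) : Set Y :=
  {t | ∀ U ∈ 𝓝 t, θ U ≠ 0}

/-- `μ` is a stationary measure for the random system given by the family `g`
of maps of the torus and the noise distribution `θ`. -/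
def IsStationaryT {n : ℕ} (g : (Fin n → ℝ) → Torus n → Torus n)
    (θ : Measure (Fin n → ℝ)) (μ : Measure (Torus n)) : Prop :=
  ∀ φ : C(Torus n, ℝ), ∫ x, ∫ v, φ (g v x) ∂θ ∂μ = ∫ x, φ x ∂μ


/-! ### Ball-covering maps of length spaces -/

section Abstract

variable {X : Type*} [PseudoMetricSpace X]

/-- The image under `g` of the ball of radius `s` about `y` contains the ball of radius `R`
about `g y`. -/
def CoversBall (g : X → X) (y : X) (s R : ℝ) : Prop :=
  Metric.ball (g y) R ⊆ g '' Metric.ball y s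

/-- Any two points can be joined by almost shortest two-step chains. -/
def AlmostMidpoints (X : Type*) [PseudoMetricSpace X] : Prop :=
  ∀ (x z : X) (s t : ℝ), 0 < s → 0 < t → dist x z < s + t → ∃ y, dist x y < s ∧ dist y z < t

theorem CoversBall.add (hX : AlmostMidpoints X) {g : X → X} {x : X} {s R t T : ℝ}
    (h : CoversBall g x s R) (hR : 0 < R) (hT : 0 < T)
    (h' : ∀ y, dist y x < s → CoversBall g y t T) : CoversBall g x (s + t) (R + T) := by
  intro z hz
  obtain ⟨p, hp, hpz⟩ := hX (g x) z R T hR hT (by rwa [Metric.mem_ball, dist_comm] at hz)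
  obtain ⟨y, hy, rfl⟩ := h (by rwa [Metric.mem_ball, dist_comm] : p ∈ Metric.ball (g x) R)
  rw [Metric.mem_ball] at hy
  obtain ⟨w, hw, rfl⟩ := h' y hy (by rwa [Metric.mem_ball, dist_comm] : z ∈ Metric.ball (g y) T)
  rw [Metric.mem_ball] at hw
  exact ⟨w, by rw [Metric.mem_ball]; linarith [dist_triangle w y x], rfl⟩

theorem CoversBall.extend (hX : AlmostMidpoints X) {g : X → X}
    (hg : ∀ y t, 0 < t → CoversBall g y t t) {x : X} {s δ u : ℝ}
    (h : CoversBall g x s (s + δ)) (hs : 0 < s + δ) (hu : s ≤ u) : CoversBall g x u (u + δ) := by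
  rcases hu.eq_or_lt with rfl | hu
  · exact h
  · have := h.add hX hs (sub_pos.2 hu) fun y _ => hg y _ (sub_pos.2 hu)
    convert this using 1 <;> ring

/-- A map whose balls are locally shrunk by factors arbitrarily close to one does not shrink
balls. -/
theorem coversBall_self_of_local [CompactSpace X] (hX : AlmostMidpoints X) {g : X → X}
    (hg : ∀ y, ∀ l < (1 : ℝ), ∃ τ > 0, ∀ y', dist y' y < τ → ∀ t, 0 < t → t < τ →
      CoversBall g y' t (l * t)) (y : X) (t : ℝ) (ht : 0 < t) : CoversBall g y t t := by
  have key : ∀ l, 0 < l → l < 1 → CoversBall g y t (l * t) := by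
    intro l hl0 hl1
    obtain ⟨τ, hτ, hτc⟩ : ∃ τ > 0, ∀ y ∈ (univ : Set X), ∀ t, 0 < t → t < τ →
        CoversBall g y t (l * t) := by
      refine isCompact_univ.induction_on
        (p := fun A => ∃ τ > 0, ∀ y ∈ A, ∀ t, 0 < t → t < τ → CoversBall g y t (l * t))
        ⟨1, one_pos, by simp⟩ ?_ ?_ ?_
      · rintro A B hAB ⟨τ, hτ, h⟩
        exact ⟨τ, hτ, fun y hy => h y (hAB hy)⟩
      · rintro A B ⟨τ, hτ, h⟩ ⟨σ, hσ, k⟩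
        refine ⟨min τ σ, lt_min hτ hσ, fun y hy t ht htm => ?_⟩
        rcases hy with hy | hy
        · exact h y hy t ht (htm.trans_le (min_le_left _ _))
        · exact k y hy t ht (htm.trans_le (min_le_right _ _))
      · intro x _
        obtain ⟨τ, hτ, h⟩ := hg x l hl1
        exact ⟨Metric.ball x τ, mem_nhdsWithin_of_mem_nhds (Metric.ball_mem_nhds x hτ), τ, hτ,
          fun y hy => h y hy⟩
    obtain ⟨m, hm⟩ := exists_nat_gt (t / τ)
    have hm0 : (0 : ℝ) < m := (div_pos ht hτ).trans hm
    have hs : 0 < t / m := div_pos ht hm0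
    have hsτ : t / m < τ := by
      rw [div_lt_iff₀ hτ] at hm
      rw [div_lt_iff₀ hm0]; linarith
    have step : ∀ k : ℕ, CoversBall g y ((k + 1) * (t / m)) ((k + 1) * (l * (t / m))) := by
      intro k
      induction k with
      | zero => simpa using hτc y trivial _ hs hsτ
      | succ k ih =>
        have := ih.add hX (by positivity) (by positivity : 0 < l * (t / m))
          fun y' _ => hτc y' trivial _ hs hsτ
        convert this using 1 <;> push_cast <;> ring
    have h := step (m - 1)
    have hm1 : ((m - 1 : ℕ) : ℝ) + 1 = m := by
      have : 1 ≤ m := by exact_mod_cast hm0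
      rw [Nat.cast_sub this]; simp
    rw [hm1] at h
    convert h using 1 <;> field_simp
  intro z hz
  rw [Metric.mem_ball] at hz
  obtain ⟨l, hl, hl1⟩ := exists_between ((div_lt_one ht).2 hz)
  refine key l ((div_nonneg dist_nonneg ht.le).trans_lt hl) hl1 ?_
  rwa [Metric.mem_ball, ← div_lt_iff₀ ht]

/-- If balls are never shrunk and are locally expanded off a finite set, then each fixed ball is
expanded by a definite amount. -/
theorem exists_coversBall_add [CompactSpace X] (hX : AlmostMidpoints X) {g : X → X}
    {K : Set X} (hK : K.Finite) (hg : ∀ y t, 0 < t → CoversBall g y t t)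
    (hexp : ∀ y ∉ K, ∃ τ > 0, ∀ y', dist y' y < τ → ∀ t, 0 < t → t < τ →
      CoversBall g y' t ((1 + τ) * t)) (x : X) {ε : ℝ} (hε : 0 < ε) :
    ∃ δ > 0, CoversBall g x ε (ε + δ) := by
  obtain ⟨r, hr0, hrK⟩ : ∃ r ∈ Ioo 0 ε, r ∉ (fun k => dist k x) '' K :=
    (Ioo_infinite hε).exists_notMem_finite (hK.image _)
  have hopen : IsOpen (Ioo 0 ε \ (fun k => dist k x) '' K) :=
    isOpen_Ioo.sdiff (hK.image _).isClosed
  obtain ⟨η, hη, hηs⟩ := Metric.nhds_basis_closedBall.mem_iff.1 (hopen.mem_nhds ⟨hr0, hrK⟩)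
  have hS : IsCompact {y : X | dist y x ∈ Metric.closedBall r η} :=
    (Metric.isClosed_closedBall.preimage (continuous_id.dist continuous_const)).isCompact
  obtain ⟨τ, hτ, hτc⟩ : ∃ τ > 0, ∀ y ∈ {y : X | dist y x ∈ Metric.closedBall r η},
      ∀ t, 0 < t → t < τ → CoversBall g y t ((1 + τ) * t) := by
    refine hS.induction_on
      (p := fun A => ∃ τ > 0, ∀ y ∈ A, ∀ t, 0 < t → t < τ → CoversBall g y t ((1 + τ) * t))
      ⟨1, one_pos, by simp⟩ ?_ ?_ ?_
    · rintro A B hAB ⟨τ, hτ, h⟩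
      exact ⟨τ, hτ, fun y hy => h y (hAB hy)⟩
    · have mono : ∀ {y : X} {t a b : ℝ}, 0 < t → a ≤ b → CoversBall g y t ((1 + b) * t) →
          CoversBall g y t ((1 + a) * t) := fun ht hab h =>
        (Metric.ball_subset_ball (by gcongr)).trans h
      rintro A B ⟨τ, hτ, h⟩ ⟨σ, hσ, k⟩
      refine ⟨min τ σ, lt_min hτ hσ, fun y hy t ht htm => ?_⟩
      rcases hy with hy | hy
      · exact mono ht (min_le_left _ _) (h y hy t ht (htm.trans_le (min_le_left _ _)))
      · exact mono ht (min_le_right _ _) (k y hy t ht (htm.trans_le (min_le_right _ _)))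
    · intro y hy
      obtain ⟨τ, hτ, h⟩ := hexp y fun hyK => (hηs hy).2 ⟨y, hyK, rfl⟩
      exact ⟨Metric.ball y τ, mem_nhdsWithin_of_mem_nhds (Metric.ball_mem_nhds y hτ), τ, hτ,
        fun y hy => h y hy⟩
  obtain ⟨t, ht0, ht⟩ := exists_between (lt_min hτ (div_pos hη (by linarith : 0 < 1 + τ)))
  have htτ : t < τ := ht.trans_le (min_le_left _ _)
  have htη : (1 + τ) * t < η := by
    have := ht.trans_le (min_le_right _ _)
    rw [lt_div_iff₀ (by linarith)] at this
    linarith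
  have hT : 0 < (1 + τ) * t := by positivity
  have htT : t < (1 + τ) * t := by nlinarith
  have hrη : r + η < ε := (hηs (by simp [abs_of_pos hη] : r + η ∈ _)).1.2
  have hcov : CoversBall g x (r + t) (r + t + τ * t) := by
    intro z hz
    obtain ⟨p, hp, hpz⟩ := hX (g x) z r ((1 + τ) * t) hr0.1 hT
      (by rw [Metric.mem_ball, dist_comm] at hz; linarith)
    obtain ⟨y, hy, rfl⟩ := hg x r hr0.1
      (by rwa [Metric.mem_ball, dist_comm] : p ∈ Metric.ball (g x) r)
    rw [Metric.mem_ball] at hy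
    have hz' : z ∈ Metric.ball (g y) ((1 + τ) * t) := by rwa [Metric.mem_ball, dist_comm]
    rcases le_or_gt (r - η) (dist y x) with hyr | hyr
    · obtain ⟨w, hw, rfl⟩ := hτc y
        (by change dist y x ∈ Metric.closedBall r η
            rw [Metric.mem_closedBall, Real.dist_eq, abs_le]
            constructor <;> linarith) t ht0 htτ hz'
      rw [Metric.mem_ball] at hw
      exact ⟨w, by rw [Metric.mem_ball]; linarith [dist_triangle w y x], rfl⟩
    · obtain ⟨w, hw, rfl⟩ := hg y _ hT hz'
      rw [Metric.mem_ball] at hw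
      exact ⟨w, by rw [Metric.mem_ball]; linarith [dist_triangle w y x], rfl⟩
  refine ⟨τ * t, by positivity, hcov.extend hX hg (by linarith [hr0.1, mul_pos hτ ht0]) ?_⟩
  linarith

/-- The expansion of balls of a fixed radius is uniform in the centre. -/
theorem exists_uniform_coversBall_add [CompactSpace X] (hX : AlmostMidpoints X) {g : X → X}
    (hc : Continuous g) (hg : ∀ y t, 0 < t → CoversBall g y t t)
    (hexp : ∀ x ε, 0 < ε → ∃ δ > 0, CoversBall g x ε (ε + δ)) {ε : ℝ} (hε : 0 < ε) :
    ∃ δ > 0, ∀ x, CoversBall g x ε (ε + δ) := by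
  suffices ∃ δ > 0, ∀ x ∈ (univ : Set X), CoversBall g x ε (ε + δ) by simpa using this
  refine isCompact_univ.induction_on
    (p := fun A => ∃ δ > 0, ∀ x ∈ A, CoversBall g x ε (ε + δ)) ⟨1, one_pos, by simp⟩ ?_ ?_ ?_
  · rintro A B hAB ⟨τ, hτ, h⟩
    exact ⟨τ, hτ, fun y hy => h y (hAB hy)⟩
  · rintro A B ⟨τ, hτ, h⟩ ⟨σ, hσ, k⟩
    refine ⟨min τ σ, lt_min hτ hσ, fun y hy => ?_⟩
    rcases hy with hy | hy
    · exact (Metric.ball_subset_ball (by gcongr; exact min_le_left _ _)).trans (h y hy)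
    · exact (Metric.ball_subset_ball (by gcongr; exact min_le_right _ _)).trans (k y hy)
  · intro x _
    obtain ⟨δ, hδ, h⟩ := hexp x (ε / 2) (half_pos hε)
    refine ⟨Metric.ball x (min (ε / 2) (δ / 4)) ∩ g ⁻¹' Metric.ball (g x) (δ / 4),
      mem_nhdsWithin_of_mem_nhds (inter_mem (Metric.ball_mem_nhds x (by positivity))
        (hc.continuousAt.preimage_mem_nhds (Metric.ball_mem_nhds _ (by positivity)))),
      δ / 2, half_pos hδ, ?_⟩
    rintro y ⟨hy, hgy⟩
    rw [Metric.mem_ball, lt_min_iff] at hy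
    rw [mem_preimage, Metric.mem_ball] at hgy
    have hext := h.extend hX hg (by positivity) (by linarith [hy.1] : ε / 2 ≤ ε - dist y x)
    refine (Metric.ball_subset_ball' ?_).trans
      (hext.trans (image_mono (Metric.ball_subset_ball' ?_)))
    · linarith [hy.2]
    · rw [dist_comm x y]; linarith

/-- If balls of radius `ε` are expanded by a definite amount, then the iterated image of each of
them is eventually the whole space. -/
theorem exists_iterate_image_ball_eq_univ [CompactSpace X] (hX : AlmostMidpoints X) {g : X → X}
    {ε δ : ℝ} (hε : 0 < ε) (hδ : 0 < δ) (hg : ∀ y t, 0 < t → CoversBall g y t t)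
    (h : ∀ x, CoversBall g x ε (ε + δ)) (x : X) :
    ∃ N : ℕ, 1 ≤ N ∧ g^[N] '' Metric.ball x ε = univ := by
  have step : ∀ N : ℕ, Metric.ball (g^[N] x) (ε + N * δ) ⊆ g^[N] '' Metric.ball x ε := by
    intro N
    induction N with
    | zero => simp
    | succ N ih =>
      have hN := (h (g^[N] x)).extend hX hg (by positivity)
        (le_add_of_nonneg_right (by positivity) : ε ≤ ε + N * δ)
      rw [Function.iterate_succ', image_comp, Function.comp_apply]
      refine Subset.trans ?_ (hN.trans (image_mono ih))
      refine Metric.ball_subset_ball (le_of_eq ?_)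
      push_cast; ring
  obtain ⟨N, hN⟩ := exists_nat_gt (Metric.diam (univ : Set X) / δ)
  refine ⟨N, ?_, eq_univ_of_forall fun z => step N ?_⟩
  · have : (0 : ℝ) < N := (div_nonneg Metric.diam_nonneg hδ.le).trans_lt hN
    exact_mod_cast this
  · rw [div_lt_iff₀ hδ] at hN
    rw [Metric.mem_ball]
    linarith [Metric.dist_le_diam_of_mem (isCompact_univ (X := X)).isBounded
      (mem_univ z) (mem_univ (g^[N] x))]

end Abstract

/-! ### The torus -/

section Torus

variable {n : ℕ}

theorem tproj_add (x y : Fin n → ℝ) : tproj n (x + y) = tproj n x + tproj n y := rfl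

theorem tproj_surjective : Function.Surjective (tproj n) := fun y =>
  ⟨fun i => (QuotientAddGroup.mk_surjective (y i)).choose,
    funext fun i => (QuotientAddGroup.mk_surjective (y i)).choose_spec⟩

theorem dist_tproj_le (x y : Fin n → ℝ) : dist (tproj n x) (tproj n y) ≤ dist x y := by
  refine (dist_pi_le_iff dist_nonneg).2 fun i => le_trans ?_ (dist_le_pi_dist x y i)
  rw [dist_eq_norm, Real.dist_eq]
  change ‖((x i - y i : ℝ) : UnitAddCircle)‖ ≤ _
  rw [UnitAddCircle.norm_eq]
  simpa using round_le (x i - y i) 0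

theorem exists_lift_dist_eq (x : Fin n → ℝ) (y : Torus n) :
    ∃ y' : Fin n → ℝ, tproj n y' = y ∧ dist y' x ≤ dist y (tproj n x) := by
  obtain ⟨y₀, rfl⟩ := tproj_surjective y
  refine ⟨fun i => y₀ i - round (y₀ i - x i), ?_, ?_⟩
  · funext i
    simp only [tproj, AddCircle.coe_sub]
    have : ((round (y₀ i - x i) : ℝ) : AddCircle (1 : ℝ)) = 0 :=
      AddCircle.coe_eq_zero_iff (1 : ℝ) |>.2 ⟨round (y₀ i - x i), by simp⟩
    rw [this, sub_zero]
  · refine (dist_pi_le_iff dist_nonneg).2 fun i =>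
      le_trans (le_of_eq ?_) (dist_le_pi_dist (tproj n y₀) (tproj n x) i)
    rw [dist_eq_norm (tproj n y₀ i), Real.dist_eq]
    change _ = ‖((y₀ i - x i : ℝ) : UnitAddCircle)‖
    rw [UnitAddCircle.norm_eq]
    congr 1; ring

theorem almostMidpoints_torus : AlmostMidpoints (Torus n) := by
  intro x z s t hs ht h
  obtain ⟨x, rfl⟩ := tproj_surjective x
  obtain ⟨z, rfl, hz⟩ := exists_lift_dist_eq x z
  obtain ⟨y, hxy, hyz⟩ := exists_dist_lt_lt hs ht
    (show dist x z < t + s by rw [dist_comm] at hz h; linarith)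
  exact ⟨tproj n y, (dist_tproj_le _ _).trans_lt hxy, (dist_tproj_le _ _).trans_lt hyz⟩

theorem continuous_of_lift {g : Torus n → Torus n} {G : (Fin n → ℝ) → Fin n → ℝ}
    (hlift : ∀ x, g (tproj n x) = tproj n (G x)) (hG : Continuous G) : Continuous g := by
  refine Metric.continuous_iff.2 fun y ε hε => ?_
  obtain ⟨y, rfl⟩ := tproj_surjective y
  obtain ⟨δ, hδ, h⟩ := Metric.continuous_iff.1 hG y ε hε
  refine ⟨δ, hδ, fun z hz => ?_⟩
  obtain ⟨z, rfl, hz'⟩ := exists_lift_dist_eq y z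
  rw [hlift, hlift]
  exact (dist_tproj_le _ _).trans_lt (h z (hz'.trans_lt hz))

theorem coversBall_tproj {g : Torus n → Torus n} {G : (Fin n → ℝ) → Fin n → ℝ}
    (hlift : ∀ x, g (tproj n x) = tproj n (G x)) {y : Fin n → ℝ} {s R : ℝ}
    (h : CoversBall G y s R) : CoversBall g (tproj n y) s R := by
  intro z hz
  rw [hlift] at hz
  obtain ⟨z, rfl, hz'⟩ := exists_lift_dist_eq (G y) z
  obtain ⟨w, hw, rfl⟩ := h (hz'.trans_lt hz)
  exact ⟨tproj n w, (dist_tproj_le _ _).trans_lt hw, hlift w⟩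

end Torus

/-- A strictly differentiable map with invertible derivative `A` covers, near the base point,
balls of radius `l * t` by balls of radius `t` as soon as `l * ‖A⁻¹‖ < 1`. -/
theorem HasStrictFDerivAt.exists_coversBall {E : Type*} [NormedAddCommGroup E] [NormedSpace ℝ E]
    [CompleteSpace E] {G : E → E} {A : E →L[ℝ] E} {y : E} (hG : HasStrictFDerivAt G A y)
    (hA : IsUnit A) {l : ℝ} (hl : 0 < l) (hlA : l * ‖Ring.inverse A‖ < 1) :
    ∃ τ > 0, ∀ y', dist y' y < τ → ∀ t, 0 < t → t < τ → CoversBall G y' t (l * t) := by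
  have hA' : ‖Ring.inverse A‖ < l⁻¹ := by rwa [← one_div, lt_div_iff₀' hl]
  obtain ⟨M, hM, hMl⟩ := exists_between hA'
  have hM0 : 0 < M := (norm_nonneg _).trans_lt hM
  have hc : 0 < M⁻¹ - l := sub_pos.2 ((lt_inv_comm₀ hl hM0).2 hMl)
  let R : A.NonlinearRightInverse :=
    { toFun := (Ring.inverse A : E →L[ℝ] E)
      nnnorm := ⟨M, hM0.le⟩
      bound' := fun z => (Ring.inverse A).le_of_opNorm_le hM.le z
      right_inv' := fun z => by
        have := Ring.mul_inverse_cancel A hA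
        exact congrArg (fun B : E →L[ℝ] E => B z) this }
  obtain ⟨s, hs, happ⟩ := hG.approximates_deriv_on_nhds (c := ⟨M⁻¹ - l, hc.le⟩) (Or.inr hc)
  obtain ⟨ρ, hρ, hρs⟩ := Metric.mem_nhds_iff.1 hs
  refine ⟨ρ / 2, half_pos hρ, fun y' hy' t ht htρ z hz => ?_⟩
  rw [Metric.mem_ball] at hz
  have hdl : dist z (G y') / l < t := by rwa [div_lt_iff₀' hl]
  have hsub : Metric.closedBall y' (dist z (G y') / l) ⊆ s :=
    (Metric.closedBall_subset_ball' (by linarith)).trans hρs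
  obtain ⟨w, hw, rfl⟩ := happ.surjOn_closedBall_of_nonlinearRightInverse R
    (div_nonneg dist_nonneg hl.le) hsub
    (show z ∈ Metric.closedBall _ ((M⁻¹ - (M⁻¹ - l)) * (dist z (G y') / l)) by
      rw [sub_sub_cancel, mul_div_cancel₀ _ hl.ne', Metric.mem_closedBall])
  exact ⟨w, Metric.closedBall_subset_ball hdl hw, rfl⟩

theorem continuous_of_norm_sub_le_rpow {E F : Type*} [NormedAddCommGroup E]
    [NormedAddCommGroup F] {φ : E → F} {C α : ℝ} (hα : 0 < α)
    (h : ∀ x y, ‖φ x - φ y‖ ≤ C * ‖x - y‖ ^ α) : Continuous φ := by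
  refine continuous_iff_continuousAt.2 fun y => tendsto_iff_norm_sub_tendsto_zero.2 ?_
  refine squeeze_zero (fun _ => norm_nonneg _) (fun x => h x y) ?_
  have hcont : Continuous fun x : E => C * ‖x - y‖ ^ α :=
    continuous_const.mul ((continuous_id.sub continuous_const).norm.rpow_const
      fun _ => Or.inr hα.le)
  simpa [Real.zero_rpow hα.ne'] using hcont.tendsto y

namespace TorusHyp

variable {n : ℕ} {α : ℝ} {f : Torus n → Torus n} {F : (Fin n → ℝ) → Fin n → ℝ}

theorem lift_add (hyp : TorusHyp n α f F) (v x : Fin n → ℝ) :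
    f (tproj n x) + tproj n v = tproj n (F x + v) := by
  rw [hyp.hlift, tproj_add]

theorem exists_coversBall (hyp : TorusHyp n α f F) (v y : Fin n → ℝ) {l : ℝ} (hl : 0 < l)
    (hly : l * ‖Ring.inverse (fderiv ℝ F y)‖ < 1) :
    ∃ τ > 0, ∀ y', dist y' (tproj n y) < τ → ∀ t, 0 < t → t < τ →
      CoversBall (fun z => f z + tproj n v) y' t (l * t) := by
  obtain ⟨C, hC⟩ := hyp.hHolder
  have hF : HasStrictFDerivAt F (fderiv ℝ F y) y :=
    hasStrictFDerivAt_of_hasFDerivAt_of_continuousAt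
      (Eventually.of_forall fun z => (hyp.hdiff z).hasFDerivAt)
      (continuous_of_norm_sub_le_rpow hyp.hα0 hC).continuousAt
  obtain ⟨τ, hτ, h⟩ := (hF.add_const v).exists_coversBall (hyp.hunit y) hl hly
  refine ⟨τ, hτ, fun y' hy' t ht htτ => ?_⟩
  obtain ⟨y', rfl, hy⟩ := exists_lift_dist_eq y y'
  exact coversBall_tproj (hyp.lift_add v) (h y' (hy.trans_lt hy') t ht htτ)

theorem coversBall_self (hyp : TorusHyp n α f F) (v : Fin n → ℝ) (y : Torus n) (t : ℝ)
    (ht : 0 < t) : CoversBall (fun z => f z + tproj n v) y t t := by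
  refine coversBall_self_of_local almostMidpoints_torus (fun y l hl => ?_) y t ht
  obtain ⟨y, rfl⟩ := tproj_surjective y
  have hl' : max l (1 / 2) < 1 := max_lt hl (by norm_num)
  have hl0 : 0 < max l (1 / 2) := lt_max_of_lt_right (by norm_num)
  obtain ⟨τ, hτ, h⟩ := hyp.exists_coversBall v y hl0
    ((mul_le_of_le_one_right hl0.le (hyp.hinvnorm y)).trans_lt hl')
  exact ⟨τ, hτ, fun y' hy' t ht htτ => (Metric.ball_subset_ball
    (mul_le_mul_of_nonneg_right (le_max_left _ _) ht.le)).trans (h y' hy' t ht htτ)⟩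

theorem exists_coversBall_of_notMem (hyp : TorusHyp n α f F) (v : Fin n → ℝ) (y : Torus n)
    (hy : y ∉ tproj n '' KsetF n F) :
    ∃ τ > 0, ∀ y', dist y' y < τ → ∀ t, 0 < t → t < τ →
      CoversBall (fun z => f z + tproj n v) y' t ((1 + τ) * t) := by
  obtain ⟨y, rfl⟩ := tproj_surjective y
  have hlt : ‖Ring.inverse (fderiv ℝ F y)‖ < 1 :=
    (hyp.hinvnorm y).lt_of_ne fun h => hy ⟨y, h, rfl⟩
  set a := ‖Ring.inverse (fderiv ℝ F y)‖
  have ha : 0 ≤ a := norm_nonneg _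
  obtain ⟨τ, hτ, h⟩ := hyp.exists_coversBall v y (l := 1 + (1 - a)) (by linarith)
    (by nlinarith [sq_pos_of_pos (sub_pos.2 hlt)])
  refine ⟨min τ (1 - a), lt_min hτ (sub_pos.2 hlt), fun y' hy' t ht htτ => ?_⟩
  exact (Metric.ball_subset_ball (by gcongr; exact min_le_right _ _)).trans
    (h y' (hy'.trans_le (min_le_left _ _)) t ht (htτ.trans_le (min_le_left _ _)))

end TorusHyp

/-- for every additive perturbation `f_v = f + v (mod ℤⁿ)`, every ball
covers the whole torus after finitely many iterates of `f_v`. -/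
theorem perturbed_iterate_image_ball_eq_univ
    (n : ℕ) (α : ℝ) (f : Torus n → Torus n) (F : (Fin n → ℝ) → Fin n → ℝ)
    (hyp : TorusHyp n α f F) :
    ∀ (v : Fin n → ℝ) (x : Torus n) (ε : ℝ), 0 < ε →
      ∃ N : ℕ, 1 ≤ N ∧ (fun y => f y + tproj n v)^[N] '' Metric.ball x ε = Set.univ := by
  intro v x ε hε
  have hc : Continuous fun y => f y + tproj n v :=
    continuous_of_lift (hyp.lift_add v) (hyp.hdiff.continuous.add continuous_const)
  obtain ⟨δ, hδ, h⟩ := exists_uniform_coversBall_add almostMidpoints_torus hc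
    (hyp.coversBall_self v)
    (fun x ε hε => exists_coversBall_add almostMidpoints_torus hyp.hKfin (hyp.coversBall_self v)
      (hyp.exists_coversBall_of_notMem v) x hε) hε
  exact exists_iterate_image_ball_eq_univ almostMidpoints_torus hε hδ (hyp.coversBall_self v) h x
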